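/- arXiv:1812.01264 — 2 statements merged into one kernel-verified Lean document; each statement's English description precedes it below -/
import Mathlib

section
/- Let L be a bounded lattice, X the set of all filters of L, Y the set of all ideals of L, and R ⊆ X × Y the relation x R y iff x ∩ y ≠ ∅. Then the map θ : L → P⁺ defined by θ(a) = {x ∈ X : a ∈ x}, into the stable set lattice P⁺ of the polarity P = (X, Y, R), is a dense and compact completion (a canonical extension) of L: θ is an injective bounded-lattice homomorphism into the complete lattice P⁺, every element of P⁺ is a join of meets of elements of θ[L] and a meet of joins of elements of θ[L], and whenever S is a set of meets of elements of θ[L], T a set of joins of elements of θ[L], and ⋀S ≤ ⋁T, there are finite S′ ⊆ S and T′ ⊆ T with ⋀S′ ≤ ⋁T′. -/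
open FirstOrder FirstOrder.Language FirstOrder.Language.Structure

namespace PaperCore

/-! ### Typed polarities and stable set lattices -/

section Pol
variable {X Y : Type*}

def rho (R : X → Y → Prop) (A : Set X) : Set Y := {y | ∀ x ∈ A, R x y}

def lam (R : X → Y → Prop) (B : Set Y) : Set X := {x | ∀ y ∈ B, R x y}

def IsStable (R : X → Y → Prop) (A : Set X) : Prop := lam R (rho R A) ⊆ A

def IsStableY (R : X → Y → Prop) (B : Set Y) : Prop := rho R (lam R B) ⊆ B

lemma rho_anti {R : X → Y → Prop} {A B : Set X} (h : A ⊆ B) : rho R B ⊆ rho R A :=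
  fun y hy x hx => hy x (h hx)

lemma lam_anti {R : X → Y → Prop} {B B' : Set Y} (h : B ⊆ B') : lam R B' ⊆ lam R B :=
  fun x hx y hy => hx y (h hy)

lemma lamrho_mono {R : X → Y → Prop} {A B : Set X} (h : A ⊆ B) :
    lam R (rho R A) ⊆ lam R (rho R B) := lam_anti (rho_anti h)

def Stable (R : X → Y → Prop) : Type _ := {A : Set X // IsStable R A}

namespace Stable

variable {R : X → Y → Prop}

instance : PartialOrder (Stable R) :=
  inferInstanceAs (PartialOrder {A : Set X // IsStable R A})

lemma le_def {A B : Stable R} : A ≤ B ↔ A.1 ⊆ B.1 := Iff.rfl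

instance : InfSet (Stable R) :=
  ⟨fun S => ⟨⋂ A ∈ S, A.1, fun x hx => Set.mem_iInter₂.2 fun A hA =>
    A.2 (lamrho_mono (Set.biInter_subset_of_mem hA) hx)⟩⟩

instance : CompleteLattice (Stable R) :=
  completeLatticeOfInf _ (fun S =>
    ⟨fun A hA => Set.biInter_subset_of_mem hA,
     fun B hB => Set.subset_iInter₂ fun A hA => hB hA⟩)

end Stable
end Pol

/-! ### Ultraproducts of indexed families (as plain quotients) -/

section UProd
variable {I : Type*}

def uSetoid (U : Ultrafilter I) (β : I → Type*) : Setoid (∀ i, β i) where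
  r f g := {i | f i = g i} ∈ U
  iseqv := by
    refine ⟨fun f => ?_, fun {f g} h => ?_, fun {f g h} h1 h2 => ?_⟩
    · exact Filter.univ_mem' (fun i => rfl)
    · exact Filter.mem_of_superset h fun i hi => (hi : f i = g i).symm
    · exact Filter.mem_of_superset (Filter.inter_mem h1 h2) fun i hi =>
        (hi.1 : f i = g i).trans hi.2

def UProd (U : Ultrafilter I) (β : I → Type*) : Type _ := Quotient (uSetoid U β)

def uMk (U : Ultrafilter I) {β : I → Type*} (f : ∀ i, β i) : UProd U β :=
  Quotient.mk (uSetoid U β) f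

lemma uMk_surjective (U : Ultrafilter I) (β : I → Type*) :
    Function.Surjective (uMk U (β := β)) := Quotient.mk''_surjective

/-- `θ(α^U)`: the subset of the ultraproduct determined by a family of subsets. -/
def thetaSet (U : Ultrafilter I) {β : I → Type*} (α : ∀ i, Set (β i)) : Set (UProd U β) :=
  fun m => Quotient.liftOn m (fun f => {i | f i ∈ α i} ∈ U) (by
    intro f g hfg
    refine propext ⟨fun hf => ?_, fun hg => ?_⟩
    · exact Filter.mem_of_superset (Filter.inter_mem hf hfg) fun i hi =>
        show g i ∈ α i from hi.2 ▸ hi.1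
    · exact Filter.mem_of_superset (Filter.inter_mem hg hfg) fun i hi =>
        show f i ∈ α i from hi.2.symm ▸ hi.1)

lemma mem_thetaSet (U : Ultrafilter I) {β : I → Type*} (α : ∀ i, Set (β i)) (f : ∀ i, β i) :
    uMk U f ∈ thetaSet U α ↔ {i | f i ∈ α i} ∈ U := Iff.rfl

end UProd

/-! ### Completions: closed/open elements, density, compactness -/

section Completion
variable {C : Type*} [CompleteLattice C]

def ClosedElt (img : Set C) (c : C) : Prop := ∃ S ⊆ img, c = sInf S

def OpenElt (img : Set C) (c : C) : Prop := ∃ S ⊆ img, c = sSup S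

/-- The completion with image `img` is dense. -/
def DenseCompletion (img : Set C) : Prop :=
  ∀ x : C, (∃ G, (∀ c ∈ G, ClosedElt img c) ∧ x = sSup G) ∧
    (∃ G, (∀ o ∈ G, OpenElt img o) ∧ x = sInf G)

/-- The completion with image `img` is compact. -/
def CompactCompletion (img : Set C) : Prop :=
  ∀ S T : Set C, (∀ c ∈ S, ClosedElt img c) → (∀ o ∈ T, OpenElt img o) →
    sInf S ≤ sSup T →
      ∃ S' T' : Finset C, ↑S' ⊆ S ∧ ↑T' ⊆ T ∧ sInf (S' : Set C) ≤ sSup (T' : Set C)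

def JoinDense (img : Set C) : Prop := ∀ x : C, ∃ G ⊆ img, x = sSup G

def MeetDense (img : Set C) : Prop := ∀ x : C, ∃ G ⊆ img, x = sInf G

/-! Canonical and MacNeille extensions of `n`-ary isotone maps. -/

variable {L : Type*}

def lowerCanExt {n : ℕ} (η : L → C) (g : (Fin n → L) → L) (x : Fin n → C) : C :=
  sSup {z | ∃ p : Fin n → C, (∀ j, ClosedElt (Set.range η) (p j)) ∧ (∀ j, p j ≤ x j) ∧
    z = sInf {w | ∃ a : Fin n → L, (∀ j, p j ≤ η (a j)) ∧ w = η (g a)}}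

def upperCanExt {n : ℕ} (η : L → C) (g : (Fin n → L) → L) (x : Fin n → C) : C :=
  sInf {z | ∃ q : Fin n → C, (∀ j, OpenElt (Set.range η) (q j)) ∧ (∀ j, x j ≤ q j) ∧
    z = sSup {w | ∃ a : Fin n → L, (∀ j, η (a j) ≤ q j) ∧ w = η (g a)}}

def lowerMacExt {n : ℕ} (η : L → C) (g : (Fin n → L) → L) (x : Fin n → C) : C :=
  sSup {w | ∃ a : Fin n → L, (∀ j, η (a j) ≤ x j) ∧ w = η (g a)}

def upperMacExt {n : ℕ} (η : L → C) (g : (Fin n → L) → L) (x : Fin n → C) : C :=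
  sInf {w | ∃ a : Fin n → L, (∀ j, x j ≤ η (a j)) ∧ w = η (g a)}

/-- `F` preserves arbitrary joins (including the empty join) in each coordinate. -/
def CompleteNormalOp {n : ℕ} (F : (Fin n → C) → C) : Prop :=
  ∀ (as : Fin n → C) (j : Fin n) (G : Set C),
    F (Function.update as j (sSup G)) = ⨆ B ∈ G, F (Function.update as j B)

/-- `F` preserves arbitrary meets (including the empty meet) in each coordinate. -/
def CompleteNormalDualOp {n : ℕ} (F : (Fin n → C) → C) : Prop :=
  ∀ (as : Fin n → C) (j : Fin n) (G : Set C),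
    F (Function.update as j (sInf G)) = ⨅ B ∈ G, F (Function.update as j B)

end Completion

/-! ### First-order polarity-based structures and definable operations -/

section FO

/-- The language with `n` fresh unary relation symbols `S₀, …, S_{n-1}`. -/
def unaryLang (n : ℕ) : FirstOrder.Language where
  Functions := fun _ => Empty
  Relations := fun k => match k with
    | 1 => Fin n
    | _ => Empty

/-- The structure interpreting each `Sₘ` as `A m`. -/
def unaryStructure {M : Type*} {n : ℕ} (A : Fin n → Set M) : (unaryLang n).Structure M where
  funMap := fun {k} f _ => f.elim
  RelMap := fun {k} => match k with
    | 0 => fun r _ => r.elim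
    | 1 => fun r v => v 0 ∈ A r
    | (_ + 2) => fun r _ => r.elim

/-- The expansion `⟨P, A₀, …, A_{n-1}⟩` of a structure by `n` set parameters. -/
def withParams {L : FirstOrder.Language} {M : Type*} [L.Structure M] {n : ℕ}
    (A : Fin n → Set M) : (L.sum (unaryLang n)).Structure M :=
  letI := unaryStructure A
  inferInstance

variable {L : FirstOrder.Language} {M : Type*} [L.Structure M]

def pX (Xb : L.Relations 1) (M : Type*) [L.Structure M] : Set M := {m | RelMap Xb ![m]}

def pR (Rb : L.Relations 2) : M → M → Prop := fun a b => RelMap Rb ![a, b]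

/-- The operation on subsets of `X` defined by a formula `φ(v)` of `𝓛*_n`:
`f^P_φ(A₀,…,A_{n-1}) = {x ∈ X : ⟨P, A⟩ ⊨ φ[x]}`. -/
def defOp (Xb : L.Relations 1) {n : ℕ}
    (φ : (L.sum (unaryLang n)).Formula (Fin 1)) (A : Fin n → Set M) : Set M :=
  {x | x ∈ pX Xb M ∧ @Formula.Realize _ M (withParams A) _ φ (fun _ => x)}

/-- Set-based polarity data inside a one-sorted universe. -/
def rhoS (Yset : Set M) (R : M → M → Prop) (A : Set M) : Set M :=
  {y | y ∈ Yset ∧ ∀ x ∈ A, R x y}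

def lamS (Xset : Set M) (R : M → M → Prop) (B : Set M) : Set M :=
  {x | x ∈ Xset ∧ ∀ y ∈ B, R x y}

def IsStableS (Xset Yset : Set M) (R : M → M → Prop) (A : Set M) : Prop :=
  A ⊆ Xset ∧ lamS Xset R (rhoS Yset R A) ⊆ A

def StableS (Xset Yset : Set M) (R : M → M → Prop) : Type _ :=
  {A : Set M // IsStableS Xset Yset R A}

namespace StableS

variable {Xset Yset : Set M} {R : M → M → Prop}

lemma lamS_subset (B : Set M) : lamS Xset R B ⊆ Xset := fun _ hx => hx.1

lemma rhoS_anti {A B : Set M} (h : A ⊆ B) : rhoS Yset R B ⊆ rhoS Yset R A :=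
  fun y hy => ⟨hy.1, fun x hx => hy.2 x (h hx)⟩

lemma lamS_anti {B B' : Set M} (h : B ⊆ B') : lamS Xset R B' ⊆ lamS Xset R B :=
  fun x hx => ⟨hx.1, fun y hy => hx.2 y (h hy)⟩

lemma lamrhoS_mono {A B : Set M} (h : A ⊆ B) :
    lamS Xset R (rhoS Yset R A) ⊆ lamS Xset R (rhoS Yset R B) :=
  lamS_anti (rhoS_anti (Yset := Yset) h)

instance : PartialOrder (StableS Xset Yset R) :=
  inferInstanceAs (PartialOrder {A : Set M // IsStableS Xset Yset R A})

lemma le_def {A B : StableS Xset Yset R} : A ≤ B ↔ A.1 ⊆ B.1 := Iff.rfl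

instance : InfSet (StableS Xset Yset R) :=
  ⟨fun S => ⟨Xset ∩ ⋂ A ∈ S, A.1,
    ⟨Set.inter_subset_left, fun x hx =>
      ⟨(lamS_subset _) hx, Set.mem_iInter₂.2 fun A hA =>
        A.2.2 (lamrhoS_mono (Set.inter_subset_right.trans (Set.biInter_subset_of_mem hA)) hx)⟩⟩⟩⟩

instance : CompleteLattice (StableS Xset Yset R) :=
  completeLatticeOfInf _ (fun S =>
    ⟨fun A hA => (Set.inter_subset_right.trans (Set.biInter_subset_of_mem hA) :
        Xset ∩ ⋂ A ∈ S, A.1 ⊆ A.1),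
     fun B hB => Set.subset_inter B.2.1 (Set.subset_iInter₂ fun A hA => hB hA)⟩)

end StableS

end FO

end PaperCore

namespace PaperCore

/-- A filter of a bounded lattice: nonempty, upward closed, closed under binary meets. -/
def IsLatFilter {L : Type*} [Lattice L] (F : Set L) : Prop :=
  F.Nonempty ∧ (∀ a ∈ F, ∀ b, a ≤ b → b ∈ F) ∧ (∀ a ∈ F, ∀ b ∈ F, a ⊓ b ∈ F)

/-- An ideal of a bounded lattice: nonempty, downward closed, closed under binary joins. -/
def IsLatIdeal {L : Type*} [Lattice L] (F : Set L) : Prop :=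
  F.Nonempty ∧ (∀ a ∈ F, ∀ b, b ≤ a → b ∈ F) ∧ (∀ a ∈ F, ∀ b ∈ F, a ⊔ b ∈ F)

end PaperCore

namespace PaperCore

namespace Stable

variable {X Y : Type*} {R : X → Y → Prop}

lemma mem_sInf {S : Set (Stable R)} {x : X} : x ∈ (sInf S).1 ↔ ∀ A ∈ S, x ∈ A.1 :=
  Set.mem_iInter₂

/-- The stable set `λ{y}` of a point `y`. -/
def lamPoint (R : X → Y → Prop) (y : Y) : Stable R :=
  ⟨{x | R x y}, fun _ hx => hx y fun _ hz => hz⟩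

end Stable

section FilterIdeal

variable {L : Type*} [Lattice L]

variable (L) in
/-- The relation of the filter-ideal polarity. -/
abbrev Meets (x : {F : Set L // IsLatFilter F}) (y : {F : Set L // IsLatIdeal F}) : Prop :=
  (x.1 ∩ y.1).Nonempty

def principalFilter (a : L) : {F : Set L // IsLatFilter F} :=
  ⟨Set.Ici a, ⟨a, le_rfl⟩, fun _ hb _ hbc => le_trans hb hbc, fun _ hb _ hc => le_inf hb hc⟩

def principalIdeal (a : L) : {F : Set L // IsLatIdeal F} :=
  ⟨Set.Iic a, ⟨a, le_rfl⟩, fun _ hb _ hcb => le_trans hcb hb, fun _ hb _ hc => sup_le hb hc⟩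

/-- The stable set of all filters containing `a`. -/
def theta (a : L) : Stable (Meets L) :=
  ⟨{x | a ∈ x.1}, fun x hx => by
    obtain ⟨b, hbx, hba⟩ := hx (principalIdeal a) fun z hz => ⟨a, hz, le_rfl⟩
    exact x.2.2.1 b hbx a hba⟩

lemma theta_le_theta {a b : L} : theta a ≤ theta b ↔ a ≤ b :=
  ⟨fun h => h (show principalFilter a ∈ (theta a).1 from le_refl a),
    fun h x hx => x.2.2.1 a hx b h⟩

lemma theta_inf (a b : L) : theta (a ⊓ b) = theta a ⊓ theta b := by
  refine le_antisymm (le_inf (theta_le_theta.2 inf_le_left) (theta_le_theta.2 inf_le_right)) ?_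
  intro x hx
  exact x.2.2.2 a ((inf_le_left : theta a ⊓ theta b ≤ theta a) hx) b
    ((inf_le_right : theta a ⊓ theta b ≤ theta b) hx)

lemma mem_of_theta_le {a : L} {U : Stable (Meets L)} (h : theta a ≤ U)
    {y : {F : Set L // IsLatIdeal F}} (hy : y ∈ rho (Meets L) U.1) : a ∈ y.1 := by
  obtain ⟨c, hac, hcy⟩ := hy _ (h (show principalFilter a ∈ (theta a).1 from le_refl a))
  exact y.2.2.1 c hcy a hac

lemma theta_sup (a b : L) : theta (a ⊔ b) = theta a ⊔ theta b := by
  refine le_antisymm ?_ (sup_le (theta_le_theta.2 le_sup_left) (theta_le_theta.2 le_sup_right))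
  intro x hx
  exact (theta a ⊔ theta b).2 fun y hy => ⟨a ⊔ b, hx,
    y.2.2.2 a (mem_of_theta_le le_sup_left hy) b (mem_of_theta_le le_sup_right hy)⟩

lemma theta_top [OrderTop L] : theta (⊤ : L) = ⊤ :=
  top_le_iff.1 fun x _ => by
    obtain ⟨a, ha⟩ := x.2.1
    exact x.2.2.1 a ha ⊤ le_top

lemma theta_bot [OrderBot L] : theta (⊥ : L) = ⊥ :=
  le_bot_iff.1 fun x hx => (⊥ : Stable (Meets L)).2 fun y _ => by
    obtain ⟨a, ha⟩ := y.2.1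
    exact ⟨⊥, hx, y.2.2.1 a ha ⊥ bot_le⟩

variable (L) in
/-- `theta` as a homomorphism of bounded lattices. -/
def thetaHom [BoundedOrder L] : BoundedLatticeHom L (Stable (Meets L)) where
  toFun := theta
  map_sup' := theta_sup
  map_inf' := theta_inf
  map_top' := theta_top
  map_bot' := theta_bot

lemma theta_injective : Function.Injective (theta : L → Stable (Meets L)) := fun _ _ h =>
  le_antisymm (theta_le_theta.1 h.le) (theta_le_theta.1 h.ge)

lemma theta_le_lamPoint {a : L} {y : {F : Set L // IsLatIdeal F}} (ha : a ∈ y.1) :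
    theta a ≤ Stable.lamPoint (Meets L) y := fun _ hx => ⟨a, hx, ha⟩

lemma lamPoint_eq_sSup (y : {F : Set L // IsLatIdeal F}) :
    Stable.lamPoint (Meets L) y = sSup (theta '' y.1) := by
  refine le_antisymm ?_ (sSup_le ?_)
  · rintro x ⟨a, hax, hay⟩
    exact (le_sSup (Set.mem_image_of_mem theta hay) : theta a ≤ sSup (theta '' y.1)) hax
  · rintro _ ⟨a, ha, rfl⟩
    exact theta_le_lamPoint ha

lemma mem_sInf_theta {x z : {F : Set L // IsLatFilter F}} :
    z ∈ (sInf (theta '' x.1)).1 ↔ x.1 ⊆ z.1 := by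
  rw [Stable.mem_sInf, Set.forall_mem_image]
  rfl

lemma sInf_theta_le {A : Stable (Meets L)} {x : {F : Set L // IsLatFilter F}} (hx : x ∈ A.1) :
    sInf (theta '' x.1) ≤ A := fun _ hz => A.2 fun y hy =>
  (hy x hx).mono (Set.inter_subset_inter_left _ (mem_sInf_theta.1 hz))

theorem denseCompletion_range_theta :
    DenseCompletion (Set.range (theta : L → Stable (Meets L))) := by
  refine fun A => ⟨⟨(fun x => sInf (theta '' x.1)) '' A.1, ?_, ?_⟩,
    ⟨Stable.lamPoint (Meets L) '' rho (Meets L) A.1, ?_, ?_⟩⟩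
  · rintro _ ⟨x, -, rfl⟩
    exact ⟨_, Set.image_subset_range _ _, rfl⟩
  · refine le_antisymm (fun x hx => ?_) (sSup_le ?_)
    · exact (le_sSup (Set.mem_image_of_mem (fun x => sInf (theta '' x.1)) hx) :
        _ ≤ sSup ((fun x => sInf (theta '' x.1)) '' A.1)) (mem_sInf_theta.2 subset_rfl)
    · rintro _ ⟨x, hx, rfl⟩
      exact sInf_theta_le hx
  · rintro _ ⟨y, -, rfl⟩
    exact ⟨_, Set.image_subset_range _ _, lamPoint_eq_sSup y⟩
  · refine le_antisymm (le_sInf ?_) fun x hx => A.2 fun y hy => ?_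
    · rintro _ ⟨y, hy, rfl⟩ x hx
      exact hy x hx
    · exact Stable.mem_sInf.1 hx _ (Set.mem_image_of_mem _ hy)

/-- The filter of all `a` whose image lies above a finite meet of elements of `S`. -/
def filterOfSet [OrderTop L] (S : Set (Stable (Meets L))) : {F : Set L // IsLatFilter F} :=
  ⟨{a | ∃ S' : Finset (Stable (Meets L)), ↑S' ⊆ S ∧ sInf (S' : Set (Stable (Meets L))) ≤ theta a},
    ⟨⊤, ∅, by simp, theta_top.ge.trans' le_top⟩,
    fun _ ⟨S', hS', h⟩ _ hab => ⟨S', hS', h.trans (theta_le_theta.2 hab)⟩, by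
      classical
      rintro a ⟨S₁, hS₁, h₁⟩ b ⟨S₂, hS₂, h₂⟩
      refine ⟨S₁ ∪ S₂, by simp [hS₁, hS₂], ?_⟩
      rw [Finset.coe_union, sInf_union, theta_inf]
      exact inf_le_inf h₁ h₂⟩

/-- The ideal of all `a` whose image lies below a finite join of elements of `T`. -/
def idealOfSet [OrderBot L] (T : Set (Stable (Meets L))) : {F : Set L // IsLatIdeal F} :=
  ⟨{a | ∃ T' : Finset (Stable (Meets L)), ↑T' ⊆ T ∧ theta a ≤ sSup (T' : Set (Stable (Meets L)))},
    ⟨⊥, ∅, by simp, theta_bot.le.trans bot_le⟩,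
    fun _ ⟨T', hT', h⟩ _ hba => ⟨T', hT', (theta_le_theta.2 hba).trans h⟩, by
      classical
      rintro a ⟨T₁, hT₁, h₁⟩ b ⟨T₂, hT₂, h₂⟩
      refine ⟨T₁ ∪ T₂, by simp [hT₁, hT₂], ?_⟩
      rw [Finset.coe_union, sSup_union, theta_sup]
      exact sup_le_sup h₁ h₂⟩

theorem compactCompletion_range_theta [BoundedOrder L] :
    CompactCompletion (Set.range (theta : L → Stable (Meets L))) := by
  intro S T hS hT hST
  have hF : filterOfSet S ∈ (sInf S).1 := by
    refine Stable.mem_sInf.2 fun c hc => ?_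
    obtain ⟨G, hG, rfl⟩ := hS c hc
    refine Stable.mem_sInf.2 fun d hd => ?_
    obtain ⟨a, rfl⟩ := hG hd
    exact ⟨{sInf G}, by simpa using hc, by simpa using sInf_le hd⟩
  have hI : sSup T ≤ Stable.lamPoint (Meets L) (idealOfSet T) := by
    refine sSup_le fun o ho => ?_
    obtain ⟨G, hG, rfl⟩ := hT o ho
    refine sSup_le fun d hd => ?_
    obtain ⟨a, rfl⟩ := hG hd
    exact theta_le_lamPoint ⟨{sSup G}, by simpa using ho, by simpa using le_sSup hd⟩
  obtain ⟨a, ⟨S', hS', h₁⟩, ⟨T', hT', h₂⟩⟩ := hI (hST hF)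
  exact ⟨S', T', hS', hT', h₁.trans h₂⟩

end FilterIdeal

end PaperCore

open PaperCore in
/-- the filter-ideal polarity of a bounded lattice `L`, with `x R y` iff
`x ∩ y ≠ ∅`, yields via `θ(a) = {x : a ∈ x}` a dense and compact completion
(canonical extension) of `L` in the stable set lattice. -/
theorem statement9 {L : Type*} [Lattice L] [BoundedOrder L] :
    ∃ Θ : BoundedLatticeHom L
      (Stable (fun (x : {F : Set L // IsLatFilter F}) (y : {F : Set L // IsLatIdeal F}) =>
        (x.1 ∩ y.1).Nonempty)),
      (∀ a : L, (Θ a).1 = {x : {F : Set L // IsLatFilter F} | a ∈ x.1}) ∧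
      Function.Injective Θ ∧
      DenseCompletion (Set.range ⇑Θ) ∧ CompactCompletion (Set.range ⇑Θ) :=
  ⟨thetaHom L, fun _ => rfl, theta_injective, denseCompletion_range_theta,
    compactCompletion_range_theta⟩
end

section
/- Let P = (X, Y, R, T) be a Lambek frame. Then for all A₀, A₁ ⊆ X: (i) A₀\A₁ = ⋂{T[x₀, −, y] : x₀ ∈ A₀ and y ∈ ρA₁} and A₀/A₁ = ⋂{T[−, x₁, y] : x₁ ∈ A₁ and y ∈ ρA₀}; (ii) the sets A₀ ⊗ A₁, A₀\A₁ and A₀/A₁ are all stable subsets of X; hence the stable set lattice P⁺ is closed under the operations ⊗, \ and /. -/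
open FirstOrder FirstOrder.Language FirstOrder.Language.Structure

namespace PaperCore
section Lambek
variable {X Y : Type*}

/-- `P` is separating. -/
def Separating (R : X → Y → Prop) : Prop :=
  (∀ x x' : X, rho R {x} = rho R {x'} → x = x') ∧
  (∀ y y' : Y, lam R {y} = lam R {y'} → y = y')

/-- `P` is reduced. -/
def Reduced (R : X → Y → Prop) : Prop :=
  (∀ x : X, ∃ y : Y, ¬ R x y ∧ ∀ x' : X, rho R {x} ⊂ rho R {x'} → R x' y) ∧
  (∀ y : Y, ∃ x : X, ¬ R x y ∧ ∀ y' : Y, lam R {y'} ⊂ lam R {y} → R x y')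

/-- A Lambek frame: separating, reduced, and all sections of `T` are stable. -/
def IsLambekFrame (R : X → Y → Prop) (T : X → X → Y → Prop) : Prop :=
  Separating R ∧ Reduced R ∧
  (∀ x₀ x₁ : X, IsStableY R {y' | T x₀ x₁ y'}) ∧
  (∀ (x₀ : X) (y : Y), IsStable R {x | T x₀ x y}) ∧
  (∀ (x₁ : X) (y : Y), IsStable R {x | T x x₁ y})

/-- Fusion: `A₀ ⊗ A₁`. -/
def fusion (R : X → Y → Prop) (T : X → X → Y → Prop) (A₀ A₁ : Set X) : Set X :=
  ⋂₀ {S | ∃ y : Y, (∀ x₀ ∈ A₀, ∀ x₁ ∈ A₁, T x₀ x₁ y) ∧ S = lam R {y}}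

/-- Left residual `A₀ \ A₁`. -/
def lres (R : X → Y → Prop) (T : X → X → Y → Prop) (A₀ A₁ : Set X) : Set X :=
  {x | ∀ x₀ ∈ A₀, ∀ y ∈ rho R A₁, T x₀ x y}

/-- Right residual `A₀ / A₁`. -/
def rres (R : X → Y → Prop) (T : X → X → Y → Prop) (A₀ A₁ : Set X) : Set X :=
  {x | ∀ x₁ ∈ A₁, ∀ y ∈ rho R A₀, T x x₁ y}

end Lambek
end PaperCore

namespace PaperCore

theorem isStable_lam {X Y : Type*} (R : X → Y → Prop) (B : Set Y) : IsStable R (lam R B) :=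
  fun _ hx y hy => hx y fun _ hx' => hx' y hy

theorem IsStable.sInter {X Y : Type*} {R : X → Y → Prop} {S : Set (Set X)}
    (hS : ∀ A ∈ S, IsStable R A) : IsStable R (⋂₀ S) :=
  fun _ hx A hA => hS A hA (lamrho_mono (Set.sInter_subset_of_mem hA) hx)

theorem isStable_fusion {X Y : Type*} (R : X → Y → Prop) (T : X → X → Y → Prop)
    (A₀ A₁ : Set X) : IsStable R (fusion R T A₀ A₁) := by
  refine IsStable.sInter ?_
  rintro _ ⟨y, -, rfl⟩
  exact isStable_lam R {y}

theorem lres_eq_sInter {X Y : Type*} (R : X → Y → Prop) (T : X → X → Y → Prop)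
    (A₀ A₁ : Set X) :
    lres R T A₀ A₁ = ⋂₀ {S | ∃ x₀ ∈ A₀, ∃ y ∈ rho R A₁, S = {x | T x₀ x y}} := by
  ext x
  constructor
  · rintro hx _ ⟨x₀, hx₀, y, hy, rfl⟩
    exact hx x₀ hx₀ y hy
  · exact fun hx x₀ hx₀ y hy => hx _ ⟨x₀, hx₀, y, hy, rfl⟩

theorem rres_eq_sInter {X Y : Type*} (R : X → Y → Prop) (T : X → X → Y → Prop)
    (A₀ A₁ : Set X) :
    rres R T A₀ A₁ = ⋂₀ {S | ∃ x₁ ∈ A₁, ∃ y ∈ rho R A₀, S = {x | T x x₁ y}} := by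
  ext x
  constructor
  · rintro hx _ ⟨x₁, hx₁, y, hy, rfl⟩
    exact hx x₁ hx₁ y hy
  · exact fun hx x₁ hx₁ y hy => hx _ ⟨x₁, hx₁, y, hy, rfl⟩

end PaperCore

open PaperCore in
/-- in a Lambek frame the residuals are intersections of stable sections of
`T`, and fusion and both residuals are stable; hence `P⁺` is closed under `⊗`, `\`, `/`. -/
theorem statement12 {X Y : Type*} {R : X → Y → Prop} {T : X → X → Y → Prop}
    (h : IsLambekFrame R T) (A₀ A₁ : Set X) :
    (lres R T A₀ A₁ = ⋂₀ {S | ∃ x₀ ∈ A₀, ∃ y ∈ rho R A₁, S = {x | T x₀ x y}}) ∧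
    (rres R T A₀ A₁ = ⋂₀ {S | ∃ x₁ ∈ A₁, ∃ y ∈ rho R A₀, S = {x | T x x₁ y}}) ∧
    IsStable R (fusion R T A₀ A₁) ∧
    IsStable R (lres R T A₀ A₁) ∧
    IsStable R (rres R T A₀ A₁) := by
  obtain ⟨-, -, -, hT₁, hT₀⟩ := h
  refine ⟨lres_eq_sInter R T A₀ A₁, rres_eq_sInter R T A₀ A₁, isStable_fusion R T A₀ A₁, ?_, ?_⟩
  · rw [lres_eq_sInter]
    refine IsStable.sInter ?_
    rintro _ ⟨x₀, -, y, -, rfl⟩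
    exact hT₁ x₀ y
  · rw [rres_eq_sInter]
    refine IsStable.sInter ?_
    rintro _ ⟨x₁, -, y, -, rfl⟩
    exact hT₀ x₁ y
end
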